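/- Let 𝔤 be a Lie algebra over a field, 𝔥 ⊆ 𝔤 a Lie subalgebra and 𝔪 ⊆ 𝔤 a subspace such that 𝔤 = 𝔥 ⊕ 𝔪 as a direct sum of subspaces and ⁅𝔥, 𝔪⁆ ⊆ 𝔪 (a reductive decomposition). Then 𝔤' := 𝔪 + ⁅𝔪, 𝔪⁆ is a Lie subalgebra of 𝔤. -/

import Mathlib

/-- The span of all brackets `⁅a, b⁆` with `a ∈ A`, `b ∈ B`. -/
def bracketSpan (K : Type*) {L : Type*} [Field K] [LieRing L] [LieAlgebra K L]
    (A B : Submodule K L) : Submodule K L :=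
  Submodule.span K {z | ∃ a ∈ A, ∃ b ∈ B, ⁅a, b⁆ = z}

/-- If `𝔤 = 𝔥 ⊕ 𝔪` is a reductive decomposition (with `𝔥` a subalgebra
and `⁅𝔥, 𝔪⁆ ⊆ 𝔪`), then `𝔤' = 𝔪 + ⁅𝔪, 𝔪⁆` is a Lie subalgebra of `𝔤`. -/
theorem stmt_2 (K : Type*) [Field K] (L : Type*) [LieRing L] [LieAlgebra K L]
    (gh gm : Submodule K L) (hcompl : IsCompl gh gm)
    (hhh : ∀ x ∈ gh, ∀ y ∈ gh, ⁅x, y⁆ ∈ gh)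
    (hhm : ∀ x ∈ gh, ∀ y ∈ gm, ⁅x, y⁆ ∈ gm) :
    ∀ x ∈ gm ⊔ bracketSpan K gm gm, ∀ y ∈ gm ⊔ bracketSpan K gm gm,
      ⁅x, y⁆ ∈ gm ⊔ bracketSpan K gm gm := by
  have key : ∀ z : L, ∀ y ∈ gm, ⁅z, y⁆ ∈ gm ⊔ bracketSpan K gm gm := by
    intro z y hy
    have hz : z ∈ gh ⊔ gm := by rw [hcompl.sup_eq_top]; trivial
    obtain ⟨h, hh, m, hm, rfl⟩ := Submodule.mem_sup.1 hz
    rw [add_lie]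
    exact add_mem (Submodule.mem_sup_left (hhm h hh y hy))
      (Submodule.mem_sup_right (Submodule.subset_span ⟨m, hm, y, hy, rfl⟩))
  intro x _ y hy
  obtain ⟨m, hm, b, hb, rfl⟩ := Submodule.mem_sup.1 hy
  rw [lie_add]
  refine add_mem (key x m hm) ?_
  unfold bracketSpan at hb
  induction hb using Submodule.span_induction with
  | mem z hz =>
    obtain ⟨a, ha, c, hc, rfl⟩ := hz
    rw [leibniz_lie]
    refine add_mem (key _ c hc) ?_
    rw [← lie_skew]
    exact neg_mem (key _ a ha)
  | zero => simp
  | add u v hu hv ihu ihv =>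
    rw [lie_add]
    exact add_mem (ihu (Submodule.add_mem_sup hm hu)) (ihv (Submodule.add_mem_sup hm hv))
  | smul c u hu ihu =>
    rw [lie_smul]
    exact Submodule.smul_mem _ c (ihu (Submodule.add_mem_sup hm hu))
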